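/- arXiv:2310.03224 — 5 statements merged into one kernel-verified Lean document; each statement's English description precedes it below -/
import Mathlib

section
/- Let n₁, n₂ be positive integers, N = n₁n₂, α > 0, ε > 0. Let S be a nonempty finite index set of cardinality n, let τ : S → ℝ, and let p : S → (Fin n₁ × Fin n₂) assign to each index an entry position. For a matrix V ∈ ℝ^{n₁×n₂} define T(V) = (1/n) ∑_{s∈S} |V_{p(s)} − τ_s|. Suppose X, X̄ ∈ ℝ^{n₁×n₂} satisfy: (i) consistency: (X_{p(s)} − τ_s)(X̄_{p(s)} − τ_s) ≥ 0 for all s ∈ S; (ii) T((X + X̄)/2) ≤ α/2 + ‖(X + X̄)/2‖_F²/(2αN) + ε; (iii) T(X) ≥ α/2 + ‖X‖_F²/(2αN) − ε and T(X̄) ≥ α/2 + ‖X̄‖_F²/(2αN) − ε. Then ‖X − X̄‖_F² ≤ 16αNε, and hence ‖X − X̄‖_F ≤ 4√(εαn₁n₂). -/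
open Finset

/-- Squared Frobenius norm of a real matrix. -/
noncomputable def frobSq {n₁ n₂ : ℕ} (X : Matrix (Fin n₁) (Fin n₂) ℝ) : ℝ :=
  ∑ i, ∑ j, (X i j) ^ 2

/-- Frobenius norm of a real matrix. -/
noncomputable def frobNorm {n₁ n₂ : ℕ} (X : Matrix (Fin n₁) (Fin n₂) ℝ) : ℝ :=
  Real.sqrt (frobSq X)

/-- `avgDist τ p V` is the average distance `(1/n) ∑ s, |V_{p(s)} - τ s|` between the
observed entries of `V` and the corresponding dithers. -/
noncomputable def avgDist {n₁ n₂ : ℕ} {S : Type*} [Fintype S]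
    (τ : S → ℝ) (p : S → Fin n₁ × Fin n₂) (V : Matrix (Fin n₁) (Fin n₂) ℝ) : ℝ :=
  (1 / (Fintype.card S : ℝ)) * ∑ s, |V (p s).1 (p s).2 - τ s|

/-- Deterministic core of Theorem 1 (eqs. (a.9)–(a.12)): under sign-consistency of
`X` and `X̄` and the two-sided concentration events for the average dither-distances,
`‖X - X̄‖_F² ≤ 16αNε` and hence `‖X - X̄‖_F ≤ 4√(εαn₁n₂)`. -/
theorem one_bit_mc_consistent_recovery
    {n₁ n₂ : ℕ} (hn₁ : 0 < n₁) (hn₂ : 0 < n₂) (α ε : ℝ) (hα : 0 < α) (hε : 0 < ε)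
    {S : Type*} [Fintype S] [Nonempty S] (τ : S → ℝ) (p : S → Fin n₁ × Fin n₂)
    (X Xbar : Matrix (Fin n₁) (Fin n₂) ℝ)
    (hcons : ∀ s : S, 0 ≤ (X (p s).1 (p s).2 - τ s) * (Xbar (p s).1 (p s).2 - τ s))
    (hmid : avgDist τ p ((1 / 2 : ℝ) • (X + Xbar)) ≤
      α / 2 + frobSq ((1 / 2 : ℝ) • (X + Xbar)) / (2 * α * ((n₁ : ℝ) * n₂)) + ε)
    (hX : α / 2 + frobSq X / (2 * α * ((n₁ : ℝ) * n₂)) - ε ≤ avgDist τ p X)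
    (hXbar : α / 2 + frobSq Xbar / (2 * α * ((n₁ : ℝ) * n₂)) - ε ≤ avgDist τ p Xbar) :
    frobSq (X - Xbar) ≤ 16 * α * ((n₁ : ℝ) * n₂) * ε ∧
      frobNorm (X - Xbar) ≤ 4 * Real.sqrt (ε * α * ((n₁ : ℝ) * n₂)) := by
  have hN : 0 < 2 * α * ((n₁ : ℝ) * n₂) := by positivity
  have hT : avgDist τ p ((1 / 2 : ℝ) • (X + Xbar)) =
      (avgDist τ p X + avgDist τ p Xbar) / 2 := by
    unfold avgDist
    rw [← mul_add, ← Finset.sum_add_distrib, mul_div_assoc, Finset.sum_div]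
    congr 1
    refine Finset.sum_congr rfl fun s _ => ?_
    have h := hcons s
    have e : ((1 / 2 : ℝ) • (X + Xbar)) (p s).1 (p s).2 - τ s =
        ((X (p s).1 (p s).2 - τ s) + (Xbar (p s).1 (p s).2 - τ s)) / 2 := by
      simp only [Matrix.smul_apply, Matrix.add_apply, smul_eq_mul]
      ring
    rw [e, abs_div, abs_two, (abs_add_eq_add_abs_iff _ _).2 (mul_nonneg_iff.1 h)]
  have hF : frobSq (X - Xbar) =
      2 * frobSq X + 2 * frobSq Xbar - 4 * frobSq ((1 / 2 : ℝ) • (X + Xbar)) := by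
    unfold frobSq
    simp only [Finset.mul_sum, ← Finset.sum_add_distrib, ← Finset.sum_sub_distrib]
    refine Finset.sum_congr rfl fun i _ => Finset.sum_congr rfl fun j _ => ?_
    simp only [Matrix.smul_apply, Matrix.add_apply, Matrix.sub_apply, smul_eq_mul]
    ring
  have h1 : frobSq (X - Xbar) ≤ 16 * α * ((n₁ : ℝ) * n₂) * ε := by
    have h2 : frobSq (X - Xbar) / (2 * α * ((n₁ : ℝ) * n₂)) ≤ 8 * ε := by
      rw [hF, sub_div, add_div, mul_div_assoc, mul_div_assoc, mul_div_assoc]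
      linarith
    rw [div_le_iff₀ hN] at h2
    linarith
  refine ⟨h1, ?_⟩
  unfold frobNorm
  apply Real.sqrt_le_iff.2
  refine ⟨by positivity, ?_⟩
  rw [mul_pow, Real.sq_sqrt (by positivity)]
  linarith
end

section
/- Let n₁, n₂ be positive integers, N = n₁n₂, α > 0, ε > 0. Let S be a nonempty finite index set of cardinality n, let τ : S → ℝ, and let p : S → (Fin n₁ × Fin n₂). For V ∈ ℝ^{n₁×n₂} define T(V) = (1/n) ∑_{s∈S} |V_{p(s)} − τ_s|. Suppose X, X̄ ∈ ℝ^{n₁×n₂} satisfy max_{i,j}|X_{i,j}| ≤ α and max_{i,j}|X̄_{i,j}| ≤ α, together with: (ii) T((X + X̄)/2) ≤ α/2 + ‖(X + X̄)/2‖_F²/(2αN) + ε; (iii) T(X) ≥ α/2 + ‖X‖_F²/(2αN) − ε and T(X̄) ≥ α/2 + ‖X̄‖_F²/(2αN) − ε. Let d_H = |G|/n where G = { s ∈ S : (X_{p(s)} − τ_s)(X̄_{p(s)} − τ_s) < 0 } is the set of indices at which the one-bit samples of X and X̄ disagree. Then ‖X − X̄‖_F² ≤ 16αNε + 8α²N·d_H,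 and hence ‖X − X̄‖_F ≤ 4√(εαn₁n₂) + 2α√(2n₁n₂·d_H). -/
open Finset

/-- Deterministic core of Theorem 2 (eqs. (p.4)–(p.9)): without sign-consistency, the
disagreement fraction `d_H = |G|/n` enters the recovery bound:
`‖X - X̄‖_F² ≤ 16αNε + 8α²N·d_H`, hence `‖X - X̄‖_F ≤ 4√(εαn₁n₂) + 2α√(2n₁n₂·d_H)`. -/
theorem one_bit_mc_inconsistent_recovery
    {n₁ n₂ : ℕ} (hn₁ : 0 < n₁) (hn₂ : 0 < n₂) (α ε : ℝ) (hα : 0 < α) (hε : 0 < ε)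
    {S : Type*} [Fintype S] [Nonempty S] (τ : S → ℝ) (p : S → Fin n₁ × Fin n₂)
    (X Xbar : Matrix (Fin n₁) (Fin n₂) ℝ)
    (hXmax : ∀ i j, |X i j| ≤ α) (hXbarmax : ∀ i j, |Xbar i j| ≤ α)
    (hmid : avgDist τ p ((1 / 2 : ℝ) • (X + Xbar)) ≤
      α / 2 + frobSq ((1 / 2 : ℝ) • (X + Xbar)) / (2 * α * ((n₁ : ℝ) * n₂)) + ε)
    (hX : α / 2 + frobSq X / (2 * α * ((n₁ : ℝ) * n₂)) - ε ≤ avgDist τ p X)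
    (hXbar : α / 2 + frobSq Xbar / (2 * α * ((n₁ : ℝ) * n₂)) - ε ≤ avgDist τ p Xbar)
    (dH : ℝ)
    (hdH : dH = ((Finset.univ.filter fun s : S =>
        (X (p s).1 (p s).2 - τ s) * (Xbar (p s).1 (p s).2 - τ s) < 0).card : ℝ) /
        (Fintype.card S : ℝ)) :
    frobSq (X - Xbar) ≤ 16 * α * ((n₁ : ℝ) * n₂) * ε + 8 * α ^ 2 * ((n₁ : ℝ) * n₂) * dH ∧
      frobNorm (X - Xbar) ≤ 4 * Real.sqrt (ε * α * ((n₁ : ℝ) * n₂)) +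
        2 * α * Real.sqrt (2 * ((n₁ : ℝ) * n₂) * dH) := by
  classical
  have hN : (0 : ℝ) < (n₁ : ℝ) * n₂ := by positivity
  have hc : (0 : ℝ) < (Fintype.card S : ℝ) := by exact_mod_cast Fintype.card_pos
  have hd0 : 0 ≤ dH := by rw [hdH]; positivity
  have hpar : frobSq X + frobSq Xbar - 2 * frobSq ((1 / 2 : ℝ) • (X + Xbar))
      = frobSq (X - Xbar) / 2 := by
    unfold frobSq
    simp only [Finset.mul_sum, Finset.sum_div, ← Finset.sum_add_distrib,
      ← Finset.sum_sub_distrib]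
    refine Finset.sum_congr rfl fun i _ => Finset.sum_congr rfl fun j _ => ?_
    simp only [Matrix.smul_apply, Matrix.add_apply, Matrix.sub_apply, smul_eq_mul]
    ring
  have hT : avgDist τ p X + avgDist τ p Xbar
      - 2 * avgDist τ p ((1 / 2 : ℝ) • (X + Xbar)) ≤ 2 * α * dH := by
    have key : ∑ s, (|X (p s).1 (p s).2 - τ s| + |Xbar (p s).1 (p s).2 - τ s|
        - 2 * |((1 / 2 : ℝ) • (X + Xbar)) (p s).1 (p s).2 - τ s|)
        ≤ ∑ s, (if (X (p s).1 (p s).2 - τ s) * (Xbar (p s).1 (p s).2 - τ s) < 0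
          then 2 * α else 0) := by
      refine Finset.sum_le_sum fun s _ => ?_
      have h1 := abs_le.mp (hXmax (p s).1 (p s).2)
      have h2 := abs_le.mp (hXbarmax (p s).1 (p s).2)
      simp only [Matrix.smul_apply, Matrix.add_apply, smul_eq_mul]
      generalize X (p s).1 (p s).2 = x at *
      generalize Xbar (p s).1 (p s).2 = y at *
      generalize τ s = t at *
      have e1 := le_abs_self (1 / 2 * (x + y) - t)
      have e2 := neg_abs_le (1 / 2 * (x + y) - t)
      split_ifs with h
      · rcases mul_neg_iff.mp h with ⟨ha, hb⟩ | ⟨ha, hb⟩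
        · rw [abs_of_pos ha, abs_of_neg hb]
          linarith [abs_nonneg (1 / 2 * (x + y) - t)]
        · rw [abs_of_neg ha, abs_of_pos hb]
          linarith [abs_nonneg (1 / 2 * (x + y) - t)]
      · rcases mul_nonneg_iff.mp (not_lt.mp h) with ⟨ha, hb⟩ | ⟨ha, hb⟩
        · rw [abs_of_nonneg ha, abs_of_nonneg hb]; linarith
        · rw [abs_of_nonpos ha, abs_of_nonpos hb]; linarith
    rw [← Finset.sum_filter, Finset.sum_const, nsmul_eq_mul, Finset.sum_sub_distrib,
      Finset.sum_add_distrib, ← Finset.mul_sum] at key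
    have k2 := mul_le_mul_of_nonneg_left key (one_div_pos.mpr hc).le
    rw [hdH]
    unfold avgDist
    refine le_trans (le_of_eq ?_) (le_trans k2 (le_of_eq ?_))
    · ring
    · ring
  have hsq : frobSq (X - Xbar) ≤
      16 * α * ((n₁ : ℝ) * n₂) * ε + 8 * α ^ 2 * ((n₁ : ℝ) * n₂) * dH := by
    have hD : (0 : ℝ) < 2 * α * ((n₁ : ℝ) * n₂) := by positivity
    have h1 : (frobSq (X - Xbar) / 2) / (2 * α * ((n₁ : ℝ) * n₂)) ≤ 4 * ε + 2 * α * dH := by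
      rw [← hpar, sub_div, add_div, mul_div_assoc]
      linarith
    rw [div_le_iff₀ hD] at h1
    linarith
  refine ⟨hsq, ?_⟩
  unfold frobNorm
  rw [Real.sqrt_le_left (by positivity)]
  have a1 := Real.sq_sqrt (show 0 ≤ ε * α * ((n₁ : ℝ) * n₂) by positivity)
  have a2 := Real.sq_sqrt (show 0 ≤ 2 * ((n₁ : ℝ) * n₂) * dH by positivity)
  have a3 : 0 ≤ α * (Real.sqrt (ε * α * ((n₁ : ℝ) * n₂)) *
    Real.sqrt (2 * ((n₁ : ℝ) * n₂) * dH)) := by positivity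
  rw [add_sq, mul_pow, mul_pow, a1, a2]
  linarith
end

section
/- Let E be a real inner product space and let h : E → ℝ be a convex function. Let a₁, a₂ ∈ E, and suppose x₁ minimizes the function x ↦ h(x) + (1/2)‖x‖² − ⟪a₁, x⟫ over E, and x₂ minimizes x ↦ h(x) + (1/2)‖x‖² − ⟪a₂, x⟫ over E. Then ⟪a₁ − a₂, x₁ − x₂⟫ ≥ ‖x₁ − x₂‖². -/
open RealInnerProductSpace

theorem prox_subgrad_aux
    {E : Type*} [NormedAddCommGroup E] [InnerProductSpace ℝ E]
    (h : E → ℝ) (hconv : ConvexOn ℝ Set.univ h) (a x : E)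
    (h₁ : IsMinOn (fun x => h x + (1 / 2) * ‖x‖ ^ 2 - ⟪a, x⟫) Set.univ x) (y : E) :
    h x + ⟪a - x, y - x⟫ ≤ h y := by
  by_contra hc
  obtain ⟨C, hC⟩ : ∃ C, C = h x + ⟪a - x, y - x⟫ - h y := ⟨_, rfl⟩
  have hC0 : 0 < C := by linarith
  have hN : 0 ≤ ‖y - x‖ ^ 2 := by positivity
  have key : ∀ t : ℝ, 0 < t → t ≤ 1 → C ≤ t / 2 * ‖y - x‖ ^ 2 := by
    intro t ht ht1
    have hm := isMinOn_iff.1 h₁ (x + t • (y - x)) (Set.mem_univ _)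
    have hcv := hconv.2 (Set.mem_univ x) (Set.mem_univ y) (sub_nonneg.2 ht1) ht.le (by ring)
    have e : (1 - t) • x + t • y = x + t • (y - x) := by module
    rw [e] at hcv
    simp only [smul_eq_mul] at hcv
    rw [norm_add_sq_real, norm_smul, mul_pow, Real.norm_eq_abs, sq_abs, inner_add_right,
      inner_smul_right, inner_smul_right] at hm
    rw [inner_sub_left] at hC
    have : t * C ≤ t * (t / 2 * ‖y - x‖ ^ 2) := by
      rw [hC]; linarith
    exact le_of_mul_le_mul_left this ht
  have hpos : 0 < C + ‖y - x‖ ^ 2 := by linarith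
  have hk := key (C / (C + ‖y - x‖ ^ 2)) (by positivity) ((div_le_one hpos).2 (by linarith))
  rw [div_div, div_mul_eq_mul_div, le_div_iff₀ (by positivity)] at hk
  have := le_of_mul_le_mul_left hk hC0
  linarith

/-- Strong monotonicity (eq. (ghadboland), after Cai–Candès–Shen): if `x₁` minimizes
`x ↦ h(x) + ½‖x‖² - ⟪a₁, x⟫` and `x₂` minimizes `x ↦ h(x) + ½‖x‖² - ⟪a₂, x⟫` for a
convex `h`, then `⟪a₁ - a₂, x₁ - x₂⟫ ≥ ‖x₁ - x₂‖²`. -/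
theorem strong_monotonicity_of_prox_minimizers
    {E : Type*} [NormedAddCommGroup E] [InnerProductSpace ℝ E]
    (h : E → ℝ) (hconv : ConvexOn ℝ Set.univ h) (a₁ a₂ x₁ x₂ : E)
    (h₁ : IsMinOn (fun x => h x + (1 / 2) * ‖x‖ ^ 2 - ⟪a₁, x⟫) Set.univ x₁)
    (h₂ : IsMinOn (fun x => h x + (1 / 2) * ‖x‖ ^ 2 - ⟪a₂, x⟫) Set.univ x₂) :
    ‖x₁ - x₂‖ ^ 2 ≤ ⟪a₁ - a₂, x₁ - x₂⟫ := by
  have e1 := prox_subgrad_aux h hconv a₁ x₁ h₁ x₂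
  have e2 := prox_subgrad_aux h hconv a₂ x₂ h₂ x₁
  rw [← real_inner_self_eq_norm_sq]
  simp only [inner_sub_left, inner_sub_right] at *
  linarith
end

section
/- Let N, M be positive integers, m > 0 a real number, and B an M×N real matrix with ‖Bx‖₂² ≤ m‖x‖₂² for all x ∈ ℝ^N. Let h : ℝ^N → ℝ be convex, t ∈ ℝ^M, and δ > 0. Suppose (x*, y*) ∈ ℝ^N × ℝ^M satisfy: x* minimizes x ↦ h(x) + (1/2)‖x‖₂² − ⟪Bᵀy*, x⟫, and y* = (y* + δ(t − Bx*))⁺ componentwise (where (v)⁺ denotes the componentwise positive part max(v_i, 0)). Let y₀ ∈ ℝ^M, let x₁ minimize x ↦ h(x) + (1/2)‖x‖₂² − ⟪Bᵀy₀, x⟫, and set y₁ = (y₀ + δ(t − Bx₁))⁺. Then ‖y₁ − y*‖₂² ≤ ‖y₀ − y*‖₂² − (2δ − δ²m)·‖x₁ − x*‖₂². -/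
open Matrix

theorem aux_min {N : ℕ} (h : (Fin N → ℝ) → ℝ) (hconv : ConvexOn ℝ Set.univ h)
    (c a z : Fin N → ℝ)
    (ha : IsMinOn (fun x : Fin N → ℝ => h x + (1 / 2) * ∑ i, (x i) ^ 2 - ∑ i, c i * x i)
      Set.univ a) :
    (h a + (1 / 2) * ∑ i, (a i) ^ 2 - ∑ i, c i * a i) + (1 / 2) * ∑ i, (z i - a i) ^ 2 ≤
      h z + (1 / 2) * ∑ i, (z i) ^ 2 - ∑ i, c i * z i := by
  have hmin : ∀ x, h a + (1 / 2) * ∑ i, (a i) ^ 2 - ∑ i, c i * a i ≤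
      h x + (1 / 2) * ∑ i, (x i) ^ 2 - ∑ i, c i * x i := fun x => ha (Set.mem_univ x)
  have key : ∀ s : ℝ, 0 < s → s < 1 →
      (1 - s) * ((1 / 2) * ∑ i, (z i - a i) ^ 2) ≤
      (h z + (1 / 2) * ∑ i, (z i) ^ 2 - ∑ i, c i * z i) -
      (h a + (1 / 2) * ∑ i, (a i) ^ 2 - ∑ i, c i * a i) := by
    intro s hs hs1
    have h1 := hmin ((1 - s) • a + s • z)
    have h2 := hconv.2 (Set.mem_univ a) (Set.mem_univ z) (by linarith : 0 ≤ 1 - s) hs.le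
      (by ring)
    have e1 : ∑ i, (((1 - s) • a + s • z) i) ^ 2 = (1 - s) * ∑ i, (a i) ^ 2 +
        s * ∑ i, (z i) ^ 2 - s * (1 - s) * ∑ i, (z i - a i) ^ 2 := by
      simp only [Finset.mul_sum, ← Finset.sum_add_distrib, ← Finset.sum_sub_distrib]
      refine Finset.sum_congr rfl fun i _ => ?_
      simp only [Pi.add_apply, Pi.smul_apply, smul_eq_mul]
      ring
    have e2 : ∑ i, c i * ((1 - s) • a + s • z) i = (1 - s) * ∑ i, c i * a i +
        s * ∑ i, c i * z i := by
      simp only [Finset.mul_sum, ← Finset.sum_add_distrib]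
      refine Finset.sum_congr rfl fun i _ => ?_
      simp only [Pi.add_apply, Pi.smul_apply, smul_eq_mul]
      ring
    rw [e1, e2] at h1
    simp only [smul_eq_mul] at h2
    refine le_of_mul_le_mul_left ?_ hs
    linarith
  have h0 := hmin z
  by_contra hc
  push Not at hc
  set D := (1 / 2) * ∑ i, (z i - a i) ^ 2
  set G := (h z + (1 / 2) * ∑ i, (z i) ^ 2 - ∑ i, c i * z i) -
      (h a + (1 / 2) * ∑ i, (a i) ^ 2 - ∑ i, c i * a i) with hG
  have hG0 : 0 ≤ G := by linarith
  have hDG : G < D := by linarith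
  have hD : 0 < D := by linarith
  have hk := key ((D - G) / (2 * D)) (by apply div_pos <;> linarith)
    (by rw [div_lt_one (by linarith)]; linarith)
  have : (1 - (D - G) / (2 * D)) * D = D - (D - G) / 2 := by field_simp
  linarith

theorem aux_tr {N M : ℕ} (B : Matrix (Fin M) (Fin N) ℝ) (y : Fin M → ℝ) (x : Fin N → ℝ) :
    ∑ i, Bᵀ.mulVec y i * x i = ∑ j, y j * B.mulVec x j := by
  have := Matrix.dotProduct_mulVec y B x
  rw [← Matrix.mulVec_transpose] at this
  exact this.symm

/-- One-step convergence estimate of Theorem 3 for the OB-SVT-I (Uzawa-type)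
iteration: with `x*` the minimizer of the Lagrangian at `y*`, `y*` a fixed point of
the projected multiplier update, `x₁` the minimizer at `y₀`, and
`y₁ = (y₀ + δ(t - Bx₁))⁺`, one has
`‖y₁ - y*‖² ≤ ‖y₀ - y*‖² - (2δ - δ²m)‖x₁ - x*‖²`. -/
theorem ob_svt_one_step_convergence
    (N M : ℕ) (hN : 0 < N) (hM : 0 < M) (m : ℝ) (hm : 0 < m)
    (B : Matrix (Fin M) (Fin N) ℝ)
    (hB : ∀ x : Fin N → ℝ, ∑ j, (B.mulVec x j) ^ 2 ≤ m * ∑ i, (x i) ^ 2)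
    (h : (Fin N → ℝ) → ℝ) (hconv : ConvexOn ℝ Set.univ h)
    (t : Fin M → ℝ) (δ : ℝ) (hδ : 0 < δ)
    (xstar : Fin N → ℝ) (ystar : Fin M → ℝ)
    (hxstar : IsMinOn
      (fun x : Fin N → ℝ => h x + (1 / 2) * ∑ i, (x i) ^ 2 - ∑ i, Bᵀ.mulVec ystar i * x i)
      Set.univ xstar)
    (hystar : ∀ j, ystar j = max (ystar j + δ * (t j - B.mulVec xstar j)) 0)
    (y₀ : Fin M → ℝ) (x₁ : Fin N → ℝ)
    (hx₁ : IsMinOn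
      (fun x : Fin N → ℝ => h x + (1 / 2) * ∑ i, (x i) ^ 2 - ∑ i, Bᵀ.mulVec y₀ i * x i)
      Set.univ x₁)
    (y₁ : Fin M → ℝ) (hy₁ : ∀ j, y₁ j = max (y₀ j + δ * (t j - B.mulVec x₁ j)) 0) :
    ∑ j, (y₁ j - ystar j) ^ 2 ≤
      ∑ j, (y₀ j - ystar j) ^ 2 - (2 * δ - δ ^ 2 * m) * ∑ i, (x₁ i - xstar i) ^ 2 := by
  have k1 := aux_min h hconv _ _ x₁ hxstar
  have k2 := aux_min h hconv _ _ xstar hx₁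
  simp only [aux_tr] at k1 k2
  have hb := hB (x₁ - xstar)
  simp only [Matrix.mulVec_sub, Pi.sub_apply] at hb
  have hsym : ∑ i, (xstar i - x₁ i) ^ 2 = ∑ i, (x₁ i - xstar i) ^ 2 :=
    Finset.sum_congr rfl fun i _ => by ring
  rw [hsym] at k2
  have hmono : ∑ i, (x₁ i - xstar i) ^ 2 ≤
      ∑ j, (y₀ j - ystar j) * (B.mulVec x₁ j - B.mulVec xstar j) := by
    have : ∑ j, (y₀ j - ystar j) * (B.mulVec x₁ j - B.mulVec xstar j) =
        ∑ j, y₀ j * B.mulVec x₁ j - ∑ j, y₀ j * B.mulVec xstar j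
        - ∑ j, ystar j * B.mulVec x₁ j + ∑ j, ystar j * B.mulVec xstar j := by
      simp only [← Finset.sum_add_distrib, ← Finset.sum_sub_distrib]
      exact Finset.sum_congr rfl fun i _ => by ring
    linarith
  have hstep : ∑ j, (y₁ j - ystar j) ^ 2 ≤ ∑ j, (y₀ j - ystar j) ^ 2
      - 2 * δ * ∑ j, (y₀ j - ystar j) * (B.mulVec x₁ j - B.mulVec xstar j)
      + δ ^ 2 * ∑ j, (B.mulVec x₁ j - B.mulVec xstar j) ^ 2 := by
    simp only [Finset.mul_sum, ← Finset.sum_add_distrib, ← Finset.sum_sub_distrib]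
    refine Finset.sum_le_sum fun j _ => ?_
    have hl := abs_max_sub_max_le_abs (y₀ j + δ * (t j - B.mulVec x₁ j))
      (ystar j + δ * (t j - B.mulVec xstar j)) 0
    rw [← hy₁ j, ← hystar j] at hl
    have := sq_le_sq.mpr hl
    linarith
  have a1 := mul_le_mul_of_nonneg_left hmono hδ.le
  have a2 := mul_le_mul_of_nonneg_left hb (sq_nonneg δ)
  linarith
end

section
/- Let N, M be positive integers, m > 0 a real number, and B an M×N real matrix with ‖Bx‖₂² ≤ m‖x‖₂² for all x ∈ ℝ^N. Let h : ℝ^N → ℝ be convex, t ∈ ℝ^M, δ > 0 with 2δ − δ²m ≥ 0, z ∈ ℝ^N, and x ∈ ℝ^N with x′ = x + z. Suppose (x′, y*) satisfy: x′ minimizes u ↦ h(u) + (1/2)‖u‖₂² − ⟪Bᵀy*, u⟫, and y* = (y* + δ(t − Bx′))⁺ componentwise. Let y₀ ∈ ℝ^M, let x₁ minimize u ↦ h(u) + (1/2)‖u‖₂² − ⟪Bᵀy₀, u⟫, and set y₁ = (y₀ + δ(t − Bx₁))⁺. Then ‖y₁ − y*‖₂² ≤ ‖y₀ − y*‖₂²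 − (2δ − δ²m)·( (1/2)‖x₁ − x‖₂² − ‖z‖₂² ). In particular, if ‖z‖₂² ≤ (1/2)‖x₁ − x‖₂², then ‖y₁ − y*‖₂ ≤ ‖y₀ − y*‖₂. -/
open Matrix

lemma subgrad_aux {N : ℕ} (h : (Fin N → ℝ) → ℝ) (hconv : ConvexOn ℝ Set.univ h)
    (c p : Fin N → ℝ)
    (hp : IsMinOn (fun u : Fin N → ℝ => h u + (1 / 2) * ∑ i, (u i) ^ 2 - ∑ i, c i * u i)
      Set.univ p) (q : Fin N → ℝ) :
    0 ≤ h q - h p + ∑ i, p i * (q i - p i) - ∑ i, c i * (q i - p i) := by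
  have key : ∀ s : ℝ, 0 < s → s ≤ 1 →
      0 ≤ (h q - h p + ∑ i, p i * (q i - p i) - ∑ i, c i * (q i - p i))
        + s / 2 * ∑ i, (q i - p i) ^ 2 := by
    intro s hs hs1
    have h1 := hconv.2 (Set.mem_univ p) (Set.mem_univ q) (sub_nonneg.2 hs1) hs.le
      (sub_add_cancel 1 s)
    have h2 := isMinOn_iff.1 hp ((1 - s) • p + s • q) (Set.mem_univ _)
    simp only [smul_eq_mul] at h1
    have e1 : ∑ i, (((1 - s) • p + s • q) i) ^ 2 = ∑ i, (p i) ^ 2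
        + 2 * s * ∑ i, p i * (q i - p i) + s ^ 2 * ∑ i, (q i - p i) ^ 2 := by
      simp only [Finset.mul_sum, ← Finset.sum_add_distrib, Pi.add_apply, Pi.smul_apply,
        smul_eq_mul]
      exact Finset.sum_congr rfl fun i _ => by ring
    have e2 : ∑ i, c i * ((1 - s) • p + s • q) i = ∑ i, c i * p i
        + s * ∑ i, c i * (q i - p i) := by
      simp only [Finset.mul_sum, ← Finset.sum_add_distrib, Pi.add_apply, Pi.smul_apply,
        smul_eq_mul]
      exact Finset.sum_congr rfl fun i _ => by ring
    simp only [e1, e2] at h2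
    refine nonneg_of_mul_nonneg_right (a := s) ?_ hs
    nlinarith
  set K := h q - h p + ∑ i, p i * (q i - p i) - ∑ i, c i * (q i - p i)
  have hD : 0 ≤ ∑ i, (q i - p i) ^ 2 := Finset.sum_nonneg fun i _ => sq_nonneg _
  set D := ∑ i, (q i - p i) ^ 2
  by_contra! hK
  have hpos : 0 < D - K + 1 := by linarith
  have h3 := key (-K / (D - K + 1)) (div_pos (by linarith) hpos)
    ((div_le_one hpos).2 (by linarith))
  have h4 : -K / (D - K + 1) * D ≤ -K := by
    rw [div_mul_eq_mul_div, div_le_iff₀ hpos]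
    nlinarith
  linarith

/-- One-step noisy convergence estimate underlying Proposition 1
(eqs. (MySteph_1)–(MySteph_3)): the one-bit comparisons are generated from the
noise-corrupted matrix `x' = x + z`, so the fixed point `(x', y*)` of the Uzawa-type
OB-SVT iteration corresponds to `x'` rather than `x`; one obtains
`‖y₁ - y*‖² ≤ ‖y₀ - y*‖² - (2δ - δ²m)(½‖x₁ - x‖² - ‖z‖²)`, and in particular
`‖y₁ - y*‖ ≤ ‖y₀ - y*‖` whenever `‖z‖² ≤ ½‖x₁ - x‖²`. -/
theorem ob_svt_noisy_one_step_convergence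
    (N M : ℕ) (hN : 0 < N) (hM : 0 < M) (m : ℝ) (hm : 0 < m)
    (B : Matrix (Fin M) (Fin N) ℝ)
    (hB : ∀ x : Fin N → ℝ, ∑ j, (B.mulVec x j) ^ 2 ≤ m * ∑ i, (x i) ^ 2)
    (h : (Fin N → ℝ) → ℝ) (hconv : ConvexOn ℝ Set.univ h)
    (t : Fin M → ℝ) (δ : ℝ) (hδ : 0 < δ) (hδm : 0 ≤ 2 * δ - δ ^ 2 * m)
    (z x x' : Fin N → ℝ) (hx' : x' = x + z)
    (ystar : Fin M → ℝ)
    (hx'min : IsMinOn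
      (fun u : Fin N → ℝ => h u + (1 / 2) * ∑ i, (u i) ^ 2 - ∑ i, Bᵀ.mulVec ystar i * u i)
      Set.univ x')
    (hystar : ∀ j, ystar j = max (ystar j + δ * (t j - B.mulVec x' j)) 0)
    (y₀ : Fin M → ℝ) (x₁ : Fin N → ℝ)
    (hx₁ : IsMinOn
      (fun u : Fin N → ℝ => h u + (1 / 2) * ∑ i, (u i) ^ 2 - ∑ i, Bᵀ.mulVec y₀ i * u i)
      Set.univ x₁)
    (y₁ : Fin M → ℝ) (hy₁ : ∀ j, y₁ j = max (y₀ j + δ * (t j - B.mulVec x₁ j)) 0) :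
    (∑ j, (y₁ j - ystar j) ^ 2 ≤
        ∑ j, (y₀ j - ystar j) ^ 2 -
          (2 * δ - δ ^ 2 * m) *
            ((1 / 2) * ∑ i, (x₁ i - x i) ^ 2 - ∑ i, (z i) ^ 2)) ∧
      (∑ i, (z i) ^ 2 ≤ (1 / 2) * ∑ i, (x₁ i - x i) ^ 2 →
        Real.sqrt (∑ j, (y₁ j - ystar j) ^ 2) ≤
          Real.sqrt (∑ j, (y₀ j - ystar j) ^ 2)) := by
  have a1 := subgrad_aux h hconv _ _ hx'min x₁
  have a2 := subgrad_aux h hconv _ _ hx₁ x'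
  have tr : ∀ y : Fin M → ℝ, ∀ v : Fin N → ℝ,
      ∑ i, Bᵀ.mulVec y i * v i = ∑ j, y j * B.mulVec v j := by
    intro y v
    have := Matrix.dotProduct_mulVec y B v
    rw [← Matrix.mulVec_transpose] at this
    exact this.symm
  have b1 := tr ystar (x₁ - x')
  have b2 := tr y₀ (x₁ - x')
  have hBd := hB (x₁ - x')
  simp only [Pi.sub_apply] at b1 b2 hBd
  have c2 : ∑ i, Bᵀ.mulVec y₀ i * (x' i - x₁ i) = -∑ i, Bᵀ.mulVec y₀ i * (x₁ i - x' i) := by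
    rw [← Finset.sum_neg_distrib]
    exact Finset.sum_congr rfl fun i _ => by ring
  have c1 : ∑ i, x' i * (x₁ i - x' i) + ∑ i, x₁ i * (x' i - x₁ i)
      = -∑ i, (x₁ i - x' i) ^ 2 := by
    rw [← Finset.sum_neg_distrib, ← Finset.sum_add_distrib]
    exact Finset.sum_congr rfl fun i _ => by ring
  have mono : ∑ i, (x₁ i - x' i) ^ 2 ≤
      ∑ j, y₀ j * B.mulVec (x₁ - x') j - ∑ j, ystar j * B.mulVec (x₁ - x') j := by
    linarith
  have proj : ∑ j, (y₁ j - ystar j) ^ 2 ≤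
      ∑ j, ((y₀ j - ystar j) - δ * B.mulVec (x₁ - x') j) ^ 2 := by
    refine Finset.sum_le_sum fun j _ => ?_
    rw [sq_le_sq]
    have e : (y₀ j - ystar j) - δ * B.mulVec (x₁ - x') j =
        (y₀ j + δ * (t j - B.mulVec x₁ j)) - (ystar j + δ * (t j - B.mulVec x' j)) := by
      rw [Matrix.mulVec_sub, Pi.sub_apply]; ring
    rw [e]
    have := abs_max_sub_max_le_abs (y₀ j + δ * (t j - B.mulVec x₁ j))
      (ystar j + δ * (t j - B.mulVec x' j)) 0
    rwa [← hy₁ j, ← hystar j] at this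
  have ex : ∑ j, ((y₀ j - ystar j) - δ * B.mulVec (x₁ - x') j) ^ 2 =
      ∑ j, (y₀ j - ystar j) ^ 2 - 2 * δ * (∑ j, y₀ j * B.mulVec (x₁ - x') j
        - ∑ j, ystar j * B.mulVec (x₁ - x') j) + δ ^ 2 * ∑ j, (B.mulVec (x₁ - x') j) ^ 2 := by
    rw [← Finset.sum_sub_distrib, Finset.mul_sum, Finset.mul_sum, ← Finset.sum_sub_distrib,
      ← Finset.sum_add_distrib]
    exact Finset.sum_congr rfl fun i _ => by ring
  have noise : (1 / 2) * ∑ i, (x₁ i - x i) ^ 2 - ∑ i, (z i) ^ 2 ≤ ∑ i, (x₁ i - x' i) ^ 2 := by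
    rw [Finset.mul_sum, ← Finset.sum_sub_distrib]
    refine Finset.sum_le_sum fun i _ => ?_
    rw [hx', Pi.add_apply]
    nlinarith [sq_nonneg (x₁ i - x i - 2 * z i)]
  have n1 := mul_le_mul_of_nonneg_left noise hδm
  have n2 := mul_le_mul_of_nonneg_left mono (by linarith : 0 ≤ 2 * δ)
  have n3 := mul_le_mul_of_nonneg_left hBd (sq_nonneg δ)
  have main : ∑ j, (y₁ j - ystar j) ^ 2 ≤
        ∑ j, (y₀ j - ystar j) ^ 2 -
          (2 * δ - δ ^ 2 * m) *
            ((1 / 2) * ∑ i, (x₁ i - x i) ^ 2 - ∑ i, (z i) ^ 2) := by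
    linarith
  refine ⟨main, fun hz => Real.sqrt_le_sqrt ?_⟩
  have := mul_nonneg hδm (sub_nonneg.2 hz)
  linarith
end
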